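/- Let P ⊂ ℝ⁵ be a 5-dimensional reflexive polytope. Then P is a CL-polytope if and only if either (i) vol(P) = 32 and |P ∩ ℤ⁵| = 243, or (ii) 15·vol(P) < 2(|P ∩ ℤ⁵| − 3), 4|P ∩ ℤ⁵| ≤ 27(vol(P) + 4), and (|P ∩ ℤ⁵| − 3 − 6·vol(P))² ≥ 72·vol(P). -/

import Mathlib

open Pointwise MeasureTheory Polynomial

noncomputable section

/-- The lattice points of a subset `S ⊆ ℝ^d`: integer vectors whose real cast lies in `S`. -/
def latticePts (d : ℕ) (S : Set (Fin d → ℝ)) : Set (Fin d → ℤ) :=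
  {x | (fun i => (x i : ℝ)) ∈ S}

/-- `P ⊆ ℝ^d` is a lattice polytope: the convex hull of finitely many integer points. -/
def IsLatticePolytope (d : ℕ) (P : Set (Fin d → ℝ)) : Prop :=
  ∃ V : Finset (Fin d → ℤ),
    P = convexHull ℝ ((fun v : Fin d → ℤ => fun i => (v i : ℝ)) '' (V : Set (Fin d → ℤ)))

/-- `P` is full-dimensional in `ℝ^d`. -/
def IsFullDim (d : ℕ) (P : Set (Fin d → ℝ)) : Prop :=
  affineSpan ℝ P = ⊤

/-- `L` is the Ehrhart polynomial of `P`: `L(m) = |mP ∩ ℤ^d|` for every natural number `m`. -/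
def IsEhrhart (d : ℕ) (P : Set (Fin d → ℝ)) (L : Polynomial ℚ) : Prop :=
  ∀ m : ℕ, L.eval (m : ℚ) = ((latticePts d ((m : ℝ) • P)).ncard : ℚ)

/-- The complex roots of a rational polynomial, counted with multiplicity. -/
def cRoots (L : Polynomial ℚ) : Multiset ℂ :=
  (L.map (algebraMap ℚ ℂ)).roots

/-- `L` is a CL-polynomial: every complex root has real part `-1/2`. -/
def IsCL (L : Polynomial ℚ) : Prop :=
  ∀ z ∈ cRoots L, z.re = -(1/2 : ℝ)

/-- `L` has only real roots: every complex root has imaginary part `0`. -/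
def IsRealRooted (L : Polynomial ℚ) : Prop :=
  ∀ z ∈ cRoots L, z.im = 0

/-- The dual (polar) body `{u : ⟨u,v⟩ ≥ -1 for all v ∈ P}`. -/
def dualBody (d : ℕ) (P : Set (Fin d → ℝ)) : Set (Fin d → ℝ) :=
  {u | ∀ v ∈ P, -1 ≤ ∑ i, u i * v i}

/-- `P` is reflexive: the origin is interior and the dual body is a lattice polytope. -/
def IsReflexive (d : ℕ) (P : Set (Fin d → ℝ)) : Prop :=
  (0 : Fin d → ℝ) ∈ interior P ∧ IsLatticePolytope d (dualBody d P)

/-- The Euclidean volume of `P ⊆ ℝ^d`. -/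
def vol (d : ℕ) (P : Set (Fin d → ℝ)) : ℝ :=
  (volume P).toReal

/-- `δ` is the δ-vector of the Ehrhart polynomial `L` in dimension `d`:
`L(m) = ∑_{j=0}^d δ_j C(d+m-j, d)` for all natural numbers `m`. -/
def HasDeltaVector (d : ℕ) (L : Polynomial ℚ) (δ : Fin (d+1) → ℤ) : Prop :=
  ∀ m : ℕ, L.eval (m : ℚ) = ∑ j : Fin (d+1), (δ j : ℚ) * (Nat.choose (d + m - (j : ℕ)) d : ℚ)

/-- The discriminant `B²C² − 4AC³ − 4B³D − 27A²D² + 18ABCD` of the cubic `Az³+Bz²+Cz+D`. -/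
def cubicDisc (A B C D : ℚ) : ℚ :=
  B^2*C^2 - 4*A*C^3 - 4*B^3*D - 27*A^2*D^2 + 18*A*B*C*D


section EulerCharacteristic

open Filter Topology Set
open scoped Classical

theorem exists_jump_of_isCompact_convex {K : Set ℝ} (hK : IsCompact K) (hc : Convex ℝ K) :
    ∃ r : ℝ, ∀ t : ℝ, ∀ᶠ s in 𝓝[>] t,
      ((if t ∈ K then 1 else 0) - (if s ∈ K then 1 else 0) : ℤ) =
        if K.Nonempty ∧ r = t then 1 else 0 := by
  rcases K.eq_empty_or_nonempty with rfl | hne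
  · exact ⟨0, fun t => by simp⟩
  have hI := eq_Icc_of_connected_compact ⟨hne, hc.isPreconnected⟩ hK
  set l := sInf K
  set r := sSup K
  have hlr : l ≤ r := by
    obtain ⟨x, hx⟩ := hne
    rw [hI] at hx
    exact hx.1.trans hx.2
  refine ⟨r, fun t => ?_⟩
  have hgt : ∀ᶠ s in 𝓝[>] t, t < s := self_mem_nhdsWithin
  have hlt : ∀ c, t < c → ∀ᶠ s in 𝓝[>] t, s < c := fun c h =>
    mem_nhdsWithin_of_mem_nhds (Iio_mem_nhds h)
  simp only [hne, true_and]
  rw [hI]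
  rcases lt_or_ge t l with h1 | h1
  · filter_upwards [hlt l h1] with s hs
    grind
  rcases lt_or_ge t r with h2 | h2
  · filter_upwards [hlt r h2, hgt] with s hs hs'
    grind
  · filter_upwards [hgt] with s hs'
    grind

theorem exists_jump_of_isOpen_convex {U : Set ℝ} (hU : IsOpen U) (hc : Convex ℝ U)
    (hb : ∃ R, ∀ x ∈ U, |x| ≤ R) :
    ∃ l : ℝ, ∀ t : ℝ, ∀ᶠ s in 𝓝[>] t,
      ((if t ∈ U then 1 else 0) - (if s ∈ U then 1 else 0) : ℤ) =
        if U.Nonempty ∧ l = t then -1 else 0 := by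
  rcases U.eq_empty_or_nonempty with rfl | hne
  · exact ⟨0, fun t => by simp⟩
  obtain ⟨R, hR⟩ := hb
  have hbb : BddBelow U := ⟨-R, fun x hx => (abs_le.1 (hR x hx)).1⟩
  have hba : BddAbove U := ⟨R, fun x hx => (abs_le.1 (hR x hx)).2⟩
  have hI : U = Ioo (sInf U) (sSup U) := by
    apply Subset.antisymm
    · have h := interior_mono (subset_Icc_csInf_csSup hbb hba)
      rwa [hU.interior_eq, interior_Icc] at h
    · exact IsConnected.Ioo_csInf_csSup_subset ⟨hne, hc.isPreconnected⟩ hbb hba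
  set l := sInf U
  set r := sSup U
  have hlr : l < r := by
    obtain ⟨x, hx⟩ := hne
    rw [hI] at hx
    exact hx.1.trans hx.2
  refine ⟨l, fun t => ?_⟩
  have hgt : ∀ᶠ s in 𝓝[>] t, t < s := self_mem_nhdsWithin
  have hlt : ∀ c, t < c → ∀ᶠ s in 𝓝[>] t, s < c := fun c h =>
    mem_nhdsWithin_of_mem_nhds (Iio_mem_nhds h)
  simp only [hne, true_and]
  rw [hI]
  rcases lt_or_ge t l with h1 | h1
  · filter_upwards [hlt l h1] with s hs
    grind
  rcases lt_or_ge t r with h2 | h2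
  · filter_upwards [hlt r h2, hgt] with s hs hs'
    grind
  · filter_upwards [hgt] with s hs'
    grind

theorem euler_relation_real {ι κ : Type*} [Fintype ι] [Fintype κ] (a : ι → ℤ) (b : κ → ℤ)
    (K : ι → Set ℝ) (U : κ → Set ℝ)
    (hK : ∀ i, IsCompact (K i)) (hKc : ∀ i, Convex ℝ (K i))
    (hU : ∀ j, IsOpen (U j)) (hUc : ∀ j, Convex ℝ (U j)) (hUb : ∀ j, ∃ R, ∀ x ∈ U j, |x| ≤ R)
    (h : ∀ t, ∑ i, a i * (if t ∈ K i then 1 else 0) + ∑ j, b j * (if t ∈ U j then 1 else 0) = 0) :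
    ∑ i, a i * (if (K i).Nonempty then 1 else 0)
      - ∑ j, b j * (if (U j).Nonempty then 1 else 0) = 0 := by
  choose r hr using fun i => exists_jump_of_isCompact_convex (hK i) (hKc i)
  choose l hl using fun j => exists_jump_of_isOpen_convex (hU j) (hUc j) (hUb j)
  have key : ∀ t, ∑ i, a i * (if (K i).Nonempty ∧ r i = t then 1 else 0)
      + ∑ j, b j * (if (U j).Nonempty ∧ l j = t then -1 else 0) = 0 := by
    intro t
    obtain ⟨s, hs1, hs2⟩ := ((eventually_all.2 fun i => hr i t).and
      (eventually_all.2 fun j => hl j t)).exists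
    simp only [← hs1, ← hs2, mul_sub, Finset.sum_sub_distrib]
    linarith [h t, h s]
  set S : Finset ℝ := Finset.univ.image r ∪ Finset.univ.image l
  have hrS : ∀ i, r i ∈ S := fun i => by simp [S]
  have hlS : ∀ j, l j ∈ S := fun j => by simp [S]
  have hsum : ∑ t ∈ S, (∑ i, a i * (if (K i).Nonempty ∧ r i = t then 1 else 0)
      + ∑ j, b j * (if (U j).Nonempty ∧ l j = t then -1 else 0)) = 0 :=
    Finset.sum_eq_zero fun t _ => key t
  rw [Finset.sum_add_distrib, Finset.sum_comm, Finset.sum_comm (s := S)] at hsum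
  refine Eq.trans ?_ hsum
  rw [sub_eq_add_neg, ← Finset.sum_neg_distrib]
  congr 1
  · refine Finset.sum_congr rfl fun i _ => ?_
    rw [← Finset.mul_sum]
    by_cases hne : (K i).Nonempty <;> simp [hne, hrS]
  · refine Finset.sum_congr rfl fun j _ => ?_
    rw [← Finset.mul_sum]
    by_cases hne : (U j).Nonempty <;> simp [hne, hlS]

theorem convex_preimage_finCons {k : ℕ} {K : Set (Fin (k + 1) → ℝ)} (hK : Convex ℝ K) (t : ℝ) :
    Convex ℝ {y : Fin k → ℝ | (Fin.cons t y : Fin (k + 1) → ℝ) ∈ K} := by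
  intro x hx y hy p q hp hq hpq
  have h := hK hx hy hp hq hpq
  simp only [mem_ofPred_eq]
  convert h using 1
  funext i
  refine Fin.cases ?_ (fun i => ?_) i
  · simp [← add_mul, hpq]
  · simp

theorem euler_relation {ι κ : Type*} [Fintype ι] [Fintype κ] (a : ι → ℤ) (b : κ → ℤ) (k : ℕ)
    (K : ι → Set (Fin k → ℝ)) (U : κ → Set (Fin k → ℝ))
    (hK : ∀ i, IsCompact (K i)) (hKc : ∀ i, Convex ℝ (K i))
    (hU : ∀ j, IsOpen (U j)) (hUc : ∀ j, Convex ℝ (U j))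
    (hUb : ∀ j, ∃ R, ∀ x ∈ U j, ∀ n, |x n| ≤ R)
    (h : ∀ t, ∑ i, a i * (if t ∈ K i then 1 else 0) + ∑ j, b j * (if t ∈ U j then 1 else 0) = 0) :
    ∑ i, a i * (if (K i).Nonempty then 1 else 0)
      + (-1) ^ k * ∑ j, b j * (if (U j).Nonempty then 1 else 0) = 0 := by
  induction k with
  | zero =>
    have hne : ∀ S : Set (Fin 0 → ℝ), S.Nonempty ↔ (0 : Fin 0 → ℝ) ∈ S := fun S =>
      ⟨fun ⟨x, hx⟩ => by rwa [Subsingleton.elim 0 x], fun hx => ⟨0, hx⟩⟩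
    simpa [hne] using h 0
  | succ k ih =>
    have hcons : ∀ t : ℝ, Continuous fun y : Fin k → ℝ => (Fin.cons t y : Fin (k + 1) → ℝ) :=
      fun t => by fun_prop
    have hmem : ∀ (S : Set (Fin (k + 1) → ℝ)) (t : ℝ),
        {y : Fin k → ℝ | (Fin.cons t y : Fin (k + 1) → ℝ) ∈ S}.Nonempty ↔
          t ∈ (fun x : Fin (k + 1) → ℝ => x 0) '' S := by
      refine fun S t => ⟨fun ⟨y, hy⟩ => ⟨_, hy, by simp⟩, ?_⟩
      rintro ⟨x, hx, rfl⟩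
      exact ⟨Fin.tail x, by simpa using hx⟩
    have hproj : IsLinearMap ℝ fun x : Fin (k + 1) → ℝ => x 0 := ⟨by simp, by simp⟩
    have hslice := fun t : ℝ => ih
      (fun i => {y | (Fin.cons t y : Fin (k + 1) → ℝ) ∈ K i})
      (fun j => {y | (Fin.cons t y : Fin (k + 1) → ℝ) ∈ U j})
      (fun i => by
        refine ((hK i).image (f := Fin.tail) (by unfold Fin.tail; fun_prop)).of_isClosed_subset
          ((hK i).isClosed.preimage (hcons t)) fun y hy => ⟨_, hy, by simp⟩)
      (fun i => convex_preimage_finCons (hKc i) t)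
      (fun j => (hU j).preimage (hcons t))
      (fun j => convex_preimage_finCons (hUc j) t)
      (fun j => by
        obtain ⟨R, hR⟩ := hUb j
        exact ⟨R, fun y hy n => by simpa using hR _ hy n.succ⟩)
      (fun y => h (Fin.cons t y))
    have hline := euler_relation_real a (fun j => (-1) ^ k * b j)
      (fun i => (fun x : Fin (k + 1) → ℝ => x 0) '' K i)
      (fun j => (fun x : Fin (k + 1) → ℝ => x 0) '' U j)
      (fun i => (hK i).image (by fun_prop))
      (fun i => (hKc i).is_linear_image hproj)
      (fun j => isOpenMap_eval 0 _ (hU j))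
      (fun j => (hUc j).is_linear_image hproj)
      (fun j => by
        obtain ⟨R, hR⟩ := hUb j
        refine ⟨R, ?_⟩
        rintro _ ⟨x, hx, rfl⟩
        exact hR x hx 0)
      (fun t => by
        have := hslice t
        simp only [hmem] at this
        simpa only [Finset.mul_sum, mul_assoc] using this)
    simp only [image_nonempty, mul_assoc, ← Finset.mul_sum] at hline
    rw [pow_succ]
    linarith

end EulerCharacteristic

section ConeReciprocity

open scoped Classical

theorem sum_neg_one_pow_card_mul_indicator {ι : Type*} [Fintype ι] [DecidableEq ι]
    (p q : ι → Prop) :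
    ∑ I : Finset ι, (-1 : ℤ) ^ I.card * (if ∀ i, if i ∈ I then q i else p i then 1 else 0) =
      ∏ i, ((if p i then 1 else 0) - (if q i then 1 else 0)) := by
  have h := Finset.prod_add (fun i => -(if q i then 1 else 0 : ℤ)) (fun i => if p i then 1 else 0)
    (Finset.univ : Finset ι)
  simp only [neg_add_eq_sub, Finset.powerset_univ] at h
  rw [h]
  refine Finset.sum_congr rfl fun I _ => ?_
  rw [Finset.prod_neg, mul_assoc, Finset.prod_ite_zero, Finset.prod_ite_zero]
  congr 1
  simp only [Finset.prod_const_one, Finset.mem_sdiff, Finset.mem_univ, true_and, ← ite_and,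
    mul_ite, mul_one, mul_zero]
  refine if_congr ⟨fun h => ⟨fun i hi => ?_, fun i hi => ?_⟩, fun h i => ?_⟩ rfl rfl
  · simpa [hi] using h i
  · simpa [hi] using h i
  · by_cases hi : i ∈ I
    · simpa [hi] using h.2 i hi
    · simpa [hi] using h.1 i hi

theorem box_indicator_identity {ι : Type*} [Fintype ι] [DecidableEq ι] (c : ι → ℝ) :
    ∑ I : Finset ι, (-1 : ℤ) ^ I.card *
        (if ∀ i, (if i ∈ I then 1 else 0) ≤ c i then 1 else 0) +
      ∑ I : Finset ι, (-(-1) ^ Fintype.card ι * (-1 : ℤ) ^ I.card) *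
        (if ∀ i, c i < (if i ∈ I then 1 else 0) then 1 else 0) = 0 := by
  have h1 := sum_neg_one_pow_card_mul_indicator (fun i => 0 ≤ c i) (fun i => 1 ≤ c i)
  have h2 := sum_neg_one_pow_card_mul_indicator (fun i => c i < 0) (fun i => c i < 1)
  have hA : ∀ I : Finset ι, (∀ i, (if i ∈ I then 1 else 0) ≤ c i) ↔
      ∀ i, if i ∈ I then 1 ≤ c i else 0 ≤ c i :=
    fun I => forall_congr' fun i => by split_ifs <;> rfl
  have hB : ∀ I : Finset ι, (∀ i, c i < (if i ∈ I then 1 else 0)) ↔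
      ∀ i, if i ∈ I then c i < 1 else c i < 0 :=
    fun I => forall_congr' fun i => by split_ifs <;> rfl
  simp only [hA, hB, mul_assoc, ← Finset.mul_sum, h1, h2]
  have h3 : ∏ i, ((if c i < 0 then 1 else 0) - (if c i < 1 then 1 else 0) : ℤ)
      = (-1) ^ Fintype.card ι * ∏ i, ((if 0 ≤ c i then 1 else 0) - (if 1 ≤ c i then 1 else 0)) := by
    rw [← Finset.card_univ, ← Finset.prod_const, ← Finset.prod_mul_distrib]
    refine Finset.prod_congr rfl fun i _ => ?_
    grind
  rw [h3, ← mul_assoc, neg_mul, ← mul_pow]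
  simp

theorem cone_reciprocity {ι E : Type*} [Fintype ι] [DecidableEq ι] [AddCommGroup E] [Module ℝ E]
    [FiniteDimensional ℝ E] (W : (ι → ℝ) →ₗ[ℝ] E) (hW : Function.Surjective W)
    (φ : E →ₗ[ℝ] ℝ) (hφ : ∀ c, φ (W c) = ∑ i, c i) (X : E) :
    ∑ I : Finset ι, (-1 : ℤ) ^ I.card *
        (if ∃ c, W c = X ∧ ∀ i, (if i ∈ I then 1 else 0) ≤ c i then 1 else 0)
      - (-1) ^ Module.finrank ℝ E * ∑ I : Finset ι, (-1 : ℤ) ^ I.card *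
        (if ∃ c, W c = X ∧ ∀ i, c i < (if i ∈ I then 1 else 0) then 1 else 0) = 0 := by
  obtain ⟨c₀, hc₀⟩ := hW X
  set k := Module.finrank ℝ (LinearMap.ker W)
  have hk : Module.finrank ℝ E + k = Fintype.card ι := by
    have := W.finrank_range_add_finrank_ker
    rwa [LinearMap.range_eq_top.2 hW, finrank_top, Module.finrank_fintype_fun_eq_card] at this
  let e : (Fin k → ℝ) ≃ₗ[ℝ] LinearMap.ker W :=
    LinearEquiv.ofFinrankEq _ _ (by simp [k])
  let f : (Fin k → ℝ) →ₗ[ℝ] (ι → ℝ) := (LinearMap.ker W).subtype ∘ₗ e.toLinearMap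
  have hfinj : Function.Injective f := Subtype.val_injective.comp e.injective
  have hfW : ∀ y, W (c₀ + f y) = X := fun y => by
    have : W (f y) = 0 := (e y).2
    rw [map_add, this, add_zero, hc₀]
  have hfsurj : ∀ c, W c = X → ∃ y, c₀ + f y = c := fun c hc =>
    ⟨e.symm ⟨c - c₀, by simp [hc, hc₀]⟩, by simp [f]⟩
  have hfemb := f.isClosedEmbedding_of_injective (LinearMap.ker_eq_bot.2 hfinj)
  have hfcont : Continuous f := hfemb.continuous
  have hbox : ∀ p q : ι → ℝ, IsCompact {y | c₀ + f y ∈ Set.Icc p q} := fun p q => by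
    have h := hfemb.isCompact_preimage (isCompact_Icc (a := p - c₀) (b := q - c₀))
    convert h using 1
    ext y
    simp [le_sub_iff_add_le', add_comm (f y)]
  have hsum : ∀ y, ∑ i, (c₀ + f y) i = φ X := fun y => by rw [← hφ, hfW]
  let bd : Finset ι → ι → ℝ := fun I i => if i ∈ I then 1 else 0
  have hbd0 : ∀ I i, 0 ≤ bd I i := fun I i => by simp only [bd]; split_ifs <;> norm_num
  have hbd1 : ∀ I i, bd I i ≤ 1 := fun I i => by simp only [bd]; split_ifs <;> norm_num
  let A : Finset ι → Set (Fin k → ℝ) := fun I => {y | ∀ i, bd I i ≤ (c₀ + f y) i}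
  let B : Finset ι → Set (Fin k → ℝ) := fun I => {y | ∀ i, (c₀ + f y) i < bd I i}
  have hA : ∀ I, IsCompact (A I) := fun I => by
    convert hbox (bd I) (fun _ => φ X) using 1
    ext y
    refine ⟨fun hy => ⟨hy, fun i => ?_⟩, fun hy => hy.1⟩
    rw [← hsum y]
    exact Finset.single_le_sum (f := fun i => (c₀ + f y) i)
      (fun j _ => (hbd0 I j).trans (hy j)) (Finset.mem_univ i)
  have hB : ∀ I, ∃ R, ∀ x ∈ B I, ∀ n, |x n| ≤ R := fun I => by
    obtain ⟨R, hR⟩ := (hbox (fun _ => 1 - ∑ _j : ι, 1 + φ X) (fun _ => 1)).isBounded.exists_norm_le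
    refine ⟨R, fun x hx n => (norm_le_pi_norm x n).trans (hR x ⟨fun i => ?_, fun i => ?_⟩)⟩
    · have h := Finset.single_le_sum (f := fun i => 1 - (c₀ + f x) i)
        (fun j _ => sub_nonneg.2 ((hx j).le.trans (hbd1 I j))) (Finset.mem_univ i)
      rw [Finset.sum_sub_distrib, hsum] at h
      linarith
    · exact (hx i).le.trans (hbd1 I i)
  have hcoord : ∀ i, Continuous fun y => (c₀ + f y) i := fun i =>
    (continuous_apply i).comp (continuous_const.add hfcont)
  have hcomb : ∀ (x y : Fin k → ℝ) (p q : ℝ), p + q = 1 → ∀ i,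
      (c₀ + f (p • x + q • y)) i = p * (c₀ + f x) i + q * (c₀ + f y) i := by
    intro x y p q hpq i
    obtain rfl : q = 1 - p := by linarith
    simp only [map_add, map_smul, Pi.add_apply, Pi.smul_apply, smul_eq_mul]
    ring
  have hAc : ∀ I, Convex ℝ (A I) := by
    intro I x hx y hy p q hp hq hpq i
    rw [hcomb x y p q hpq]
    have h1 := mul_le_mul_of_nonneg_left (hx i) hp
    have h2 := mul_le_mul_of_nonneg_left (hy i) hq
    have h3 : p * bd I i + q * bd I i = bd I i := by rw [← add_mul, hpq, one_mul]
    linarith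
  have hBc : ∀ I, Convex ℝ (B I) := by
    intro I
    have : B I = ⋂ i, {y | (c₀ + f y) i < bd I i} := by ext; simp [B]
    rw [this]
    refine convex_iInter fun i => ?_
    have h : ConvexOn ℝ Set.univ fun y => (c₀ + f y) i :=
      ⟨convex_univ, fun x _ y _ p q _ _ hpq => (hcomb x y p q hpq i).le⟩
    simpa using h.convex_lt (bd I i)
  have hBo : ∀ I, IsOpen (B I) := by
    intro I
    have : B I = ⋂ i, {y | (c₀ + f y) i < bd I i} := by ext; simp [B]
    rw [this]
    exact isOpen_iInter_of_finite fun i => isOpen_lt (hcoord i) continuous_const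
  have hAne : ∀ I, (A I).Nonempty ↔ ∃ c, W c = X ∧ ∀ i, (if i ∈ I then 1 else 0) ≤ c i := by
    refine fun I => ⟨fun ⟨y, hy⟩ => ⟨_, hfW y, hy⟩, ?_⟩
    rintro ⟨c, hc, hi⟩
    obtain ⟨y, rfl⟩ := hfsurj c hc
    exact ⟨y, hi⟩
  have hBne : ∀ I, (B I).Nonempty ↔ ∃ c, W c = X ∧ ∀ i, c i < (if i ∈ I then 1 else 0) := by
    refine fun I => ⟨fun ⟨y, hy⟩ => ⟨_, hfW y, hy⟩, ?_⟩
    rintro ⟨c, hc, hi⟩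
    obtain ⟨y, rfl⟩ := hfsurj c hc
    exact ⟨y, hi⟩
  have hE := euler_relation (fun I : Finset ι => (-1 : ℤ) ^ I.card)
    (fun I : Finset ι => -(-1) ^ Fintype.card ι * (-1 : ℤ) ^ I.card) k A B hA hAc hBo hBc hB
    (fun y => by convert box_indicator_identity (c₀ + f y) <;> exact Iff.rfl)
  simp only [hAne, hBne, mul_assoc, ← Finset.mul_sum] at hE
  have h5 : (-1 : ℤ) ^ k * (-1) ^ Fintype.card ι = (-1) ^ Module.finrank ℝ E := by
    rw [← hk, pow_add]
    have : ((-1 : ℤ) ^ k) * (-1) ^ k = 1 := by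
      rw [← mul_pow]; simp
    linear_combination (-1 : ℤ) ^ Module.finrank ℝ E * this
  rw [← h5]
  linear_combination hE

end ConeReciprocity

section LatticePolytope

/-- The inclusion `ℤ^d → ℝ^d`. -/
def castVec {d : ℕ} (v : Fin d → ℤ) : Fin d → ℝ := fun i => (v i : ℝ)

theorem castVec_injective {d : ℕ} : Function.Injective (castVec (d := d)) := fun x y h =>
  funext fun i => by simpa [castVec] using congrFun h i

/-- The map `c ↦ (∑ c_v v, ∑ c_v)`, which sends the nonnegative orthant onto the cone over the
convex hull of `V` placed at height one. -/
def coneMap {d : ℕ} (V : Finset (Fin d → ℤ)) : (V → ℝ) →ₗ[ℝ] (Fin d → ℝ) × ℝ :=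
  (Fintype.linearCombination ℝ fun v : V => castVec (v : Fin d → ℤ)).prod
    (Fintype.linearCombination ℝ fun _ => (1 : ℝ))

theorem coneMap_apply {d : ℕ} (V : Finset (Fin d → ℤ)) (c : V → ℝ) :
    coneMap V c = (∑ v, c v • castVec (v : Fin d → ℤ), ∑ v, c v) := by
  simp [coneMap, Fintype.linearCombination_apply]

theorem mem_convexHull_castVec_iff {d : ℕ} (V : Finset (Fin d → ℤ)) (x : Fin d → ℝ) :
    x ∈ convexHull ℝ (castVec '' (V : Set (Fin d → ℤ))) ↔
      ∃ c, coneMap V c = (x, 1) ∧ ∀ v, 0 ≤ c v := by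
  classical
  rw [← Finset.coe_image, Finset.mem_convexHull]
  simp only [coneMap_apply, Prod.mk.injEq]
  constructor
  · rintro ⟨w, hw, hw1, hx⟩
    refine ⟨fun v => w (castVec v), ⟨?_, ?_⟩, fun v => hw _ (Finset.mem_image_of_mem _ v.2)⟩
    · rw [Finset.centerMass_eq_of_sum_1 _ _ hw1,
        Finset.sum_image fun a _ b _ h => castVec_injective h] at hx
      rw [← hx, ← Finset.sum_coe_sort V]
      rfl
    · rw [Finset.sum_image fun a _ b _ h => castVec_injective h] at hw1
      rw [← hw1, ← Finset.sum_coe_sort V]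
  · rintro ⟨c, ⟨hx, hc1⟩, hc⟩
    refine (Finset.mem_convexHull (R := ℝ)).1 ?_
    rw [← hx]
    exact (convex_convexHull ℝ _).sum_mem (fun v _ => hc v) hc1 fun v _ =>
      subset_convexHull ℝ _ (Finset.mem_coe.2 (Finset.mem_image_of_mem _ v.2))

theorem mem_smul_convexHull_castVec_iff {d : ℕ} {V : Finset (Fin d → ℤ)} (hV : V.Nonempty)
    (x : Fin d → ℝ) (r : ℝ) :
    (0 ≤ r ∧ x ∈ r • convexHull ℝ (castVec '' (V : Set (Fin d → ℤ)))) ↔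
      ∃ c, coneMap V c = (x, r) ∧ ∀ v, 0 ≤ c v := by
  constructor
  · rintro ⟨hr, y, hy, rfl⟩
    obtain ⟨c, hc, hc0⟩ := (mem_convexHull_castVec_iff V y).1 hy
    refine ⟨r • c, ?_, fun v => mul_nonneg hr (hc0 v)⟩
    rw [map_smul, hc]
    simp
  · rintro ⟨c, hc, hc0⟩
    have hr : 0 ≤ r := by
      rw [coneMap_apply, Prod.mk.injEq] at hc
      exact hc.2 ▸ Finset.sum_nonneg fun v _ => hc0 v
    refine ⟨hr, ?_⟩
    rcases hr.eq_or_lt with rfl | hr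
    · rw [coneMap_apply, Prod.mk.injEq] at hc
      have h0 := (Finset.sum_eq_zero_iff_of_nonneg fun v _ => hc0 v).1 hc.2
      have hx : x = 0 := by
        rw [← hc.1]
        exact Finset.sum_eq_zero fun v hv => by rw [h0 v hv, zero_smul]
      obtain ⟨v, hv⟩ := hV
      exact ⟨castVec v, subset_convexHull ℝ _ ⟨v, hv, rfl⟩, by simp [hx]⟩
    · rw [Set.mem_smul_set_iff_inv_smul_mem₀ hr.ne', mem_convexHull_castVec_iff]
      refine ⟨r⁻¹ • c, ?_, fun v => mul_nonneg (inv_nonneg.2 hr.le) (hc0 v)⟩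
      rw [map_smul, hc]
      simp [hr.ne']

theorem exists_pos_smul_mem_of_mem_interior {E : Type*} [NormedAddCommGroup E] [NormedSpace ℝ E]
    {P : Set E} (h0 : (0 : E) ∈ interior P) (x : E) : ∃ ε : ℝ, 0 < ε ∧ ε • x ∈ P := by
  have hcont : Filter.Tendsto (fun ε : ℝ => ε • x) (nhdsWithin 0 (Set.Ioi 0)) (nhds 0) := by
    have : Filter.Tendsto (fun ε : ℝ => ε • x) (nhds 0) (nhds ((0 : ℝ) • x)) :=
      (continuous_id.smul continuous_const).tendsto 0
    rw [zero_smul] at this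
    exact this.mono_left nhdsWithin_le_nhds
  obtain ⟨ε, h, hε⟩ := ((hcont.eventually (mem_interior_iff_mem_nhds.1 h0)).and
    (self_mem_nhdsWithin : ∀ᶠ ε : ℝ in nhdsWithin 0 (Set.Ioi 0), ε ∈ Set.Ioi 0)).exists
  exact ⟨ε, hε, h⟩

theorem exists_pos_coneMap_eq_zero_one {d : ℕ} {V : Finset (Fin d → ℤ)}
    (h0 : (0 : Fin d → ℝ) ∈ interior (convexHull ℝ (castVec '' (V : Set (Fin d → ℤ))))) :
    ∃ c, coneMap V c = (0, 1) ∧ ∀ v, 0 < c v := by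
  obtain ⟨ε, hε, h⟩ := exists_pos_smul_mem_of_mem_interior h0 (-(coneMap V fun _ => 1).1)
  obtain ⟨c, hc, hc0⟩ := (mem_convexHull_castVec_iff V _).1 h
  have hs : 0 < 1 + ε * (V.card : ℝ) := by positivity
  refine ⟨(1 + ε * (V.card : ℝ))⁻¹ • (c + ε • fun _ => 1), ?_, fun v => ?_⟩
  · rw [map_smul, map_add, map_smul, hc]
    have h2 : (coneMap V fun _ => 1).2 = V.card := by simp [coneMap_apply]
    ext i
    · simp
    · simp only [Prod.smul_snd, Prod.snd_add, h2, smul_eq_mul]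
      exact inv_mul_cancel₀ hs.ne'
  · have := hc0 v
    simp only [Pi.smul_apply, Pi.add_apply, smul_eq_mul, mul_one]
    positivity

theorem coneMap_surjective {d : ℕ} {V : Finset (Fin d → ℤ)}
    (h0 : (0 : Fin d → ℝ) ∈ interior (convexHull ℝ (castVec '' (V : Set (Fin d → ℤ))))) :
    Function.Surjective (coneMap V) := by
  rintro ⟨x, m⟩
  obtain ⟨μ, hμ, -⟩ := exists_pos_coneMap_eq_zero_one h0
  obtain ⟨ε, hε, h⟩ := exists_pos_smul_mem_of_mem_interior h0 x
  obtain ⟨c, hc, -⟩ := (mem_convexHull_castVec_iff V _).1 h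
  refine ⟨ε⁻¹ • c + (m - ε⁻¹) • μ, ?_⟩
  rw [map_add, map_smul, map_smul, hc, hμ]
  simp [smul_smul, hε.ne']

theorem exists_mem_dualBody_lt {d : ℕ} {P : Set (Fin d → ℝ)} (hc : Convex ℝ P) (hP : IsCompact P)
    (h0 : (0 : Fin d → ℝ) ∈ interior P) {r : ℝ} {x : Fin d → ℝ} (hx : x ∉ r • P) :
    ∃ u ∈ dualBody d P, ∑ i, u i * x i < -r := by
  obtain ⟨f, s, hfx, hfs⟩ := geometric_hahn_banach_point_closed (hc.smul r)
    (hP.smul r).isClosed hx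
  obtain ⟨p, hpP, hp⟩ := hP.exists_isMinOn ⟨0, interior_subset h0⟩ f.continuous.continuousOn
  have hmin : ∀ y ∈ P, f p ≤ f y := fun y hy => hp hy
  have hneg : f p < 0 := by
    obtain ⟨ε, hε, h⟩ := exists_pos_smul_mem_of_mem_interior h0 x
    by_contra! hge
    have h1 := hmin _ h
    have h2 := hmin _ (interior_subset h0)
    have h3 := hfs _ (Set.smul_mem_smul_set hpP)
    rw [map_zero] at h2
    have hp0 : f p = 0 := le_antisymm h2 hge
    rw [map_smul, smul_eq_mul] at h1 h3
    rw [hp0] at h1 h3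
    nlinarith
  have hsum : ∀ y, ∑ i, ((-f p)⁻¹ * f (Pi.single i 1)) * y i = (-f p)⁻¹ * f y := fun y => by
    conv_rhs => rw [← Finset.univ_sum_single y]
    rw [map_sum, Finset.mul_sum]
    refine Finset.sum_congr rfl fun i _ => ?_
    have : Pi.single i (y i) = y i • (Pi.single i 1 : Fin d → ℝ) := by
      rw [← Pi.single_smul, smul_eq_mul, mul_one]
    rw [this, map_smul, smul_eq_mul]
    ring
  have hinv : 0 < (-f p)⁻¹ := inv_pos.2 (by linarith)
  have hmul : (-f p)⁻¹ * f p = -1 := by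
    rw [inv_neg, neg_mul, inv_mul_cancel₀ hneg.ne]
  refine ⟨fun i => (-f p)⁻¹ * f (Pi.single i 1), fun y hy => ?_, ?_⟩
  · rw [hsum, ← hmul]
    exact mul_le_mul_of_nonneg_left (hmin y hy) hinv.le
  · rw [hsum]
    have h3 := hfs _ (Set.smul_mem_smul_set hpP)
    rw [map_smul, smul_eq_mul] at h3
    have := mul_lt_mul_of_pos_left (hfx.trans h3) hinv
    linear_combination this + r * hmul

theorem exists_pos_coneMap_iff {d : ℕ} {V : Finset (Fin d → ℤ)} (hV : V.Nonempty)
    (h0 : (0 : Fin d → ℝ) ∈ interior (convexHull ℝ (castVec '' (V : Set (Fin d → ℤ)))))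
    (hdual : IsLatticePolytope d (dualBody d (convexHull ℝ (castVec '' (V : Set (Fin d → ℤ))))))
    (x : Fin d → ℤ) (m : ℤ) :
    (∃ c, coneMap V c = (castVec x, (m : ℝ)) ∧ ∀ v, 0 < c v) ↔
      0 ≤ m - 1 ∧ castVec x ∈ ((m - 1 : ℤ) : ℝ) •
        convexHull ℝ (castVec '' (V : Set (Fin d → ℤ))) := by
  obtain ⟨μ, hμ, hμ0⟩ := exists_pos_coneMap_eq_zero_one h0
  constructor
  · rintro ⟨c, hc, hc0⟩
    rw [coneMap_apply, Prod.mk.injEq] at hc hμ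
    have : Nonempty V := hV.to_subtype
    have hm : 0 ≤ m - 1 := by
      have : (0 : ℝ) < m := hc.2 ▸ Finset.sum_pos (fun v _ => hc0 v) Finset.univ_nonempty
      have : 0 < m := by exact_mod_cast this
      omega
    refine ⟨hm, ?_⟩
    by_contra hx
    obtain ⟨u, hu, hux⟩ := exists_mem_dualBody_lt (convex_convexHull ℝ _)
      ((V.finite_toSet.image _).isCompact_convexHull ℝ) h0 hx
    obtain ⟨U, hU⟩ := hdual
    have hge : ∀ w ∈ U, -((m - 1 : ℤ) : ℝ) ≤ ∑ i, castVec w i * castVec x i := by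
      intro w hw
      have hwd : castVec w ∈ dualBody d (convexHull ℝ (castVec '' (V : Set (Fin d → ℤ)))) := by
        rw [hU]
        exact subset_convexHull ℝ _ ⟨w, hw, rfl⟩
      have hval : ∀ v : V, -1 ≤ ∑ i, castVec w i * castVec (v : Fin d → ℤ) i := fun v =>
        hwd _ (subset_convexHull ℝ _ ⟨v, v.2, rfl⟩)
      have hlin : ∀ (b : V → ℝ), ∑ i, castVec w i * (∑ v, b v • castVec (v : Fin d → ℤ)) i =
          ∑ v, b v * ∑ i, castVec w i * castVec (v : Fin d → ℤ) i := by
        intro b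
        simp only [Finset.sum_apply, Pi.smul_apply, smul_eq_mul, Finset.mul_sum]
        rw [Finset.sum_comm]
        exact Finset.sum_congr rfl fun v _ => Finset.sum_congr rfl fun i _ => by ring
      obtain ⟨v₀, hv₀⟩ : ∃ v : V, -1 < ∑ i, castVec w i * castVec (v : Fin d → ℤ) i := by
        by_contra! hall
        have heq : ∀ v : V, ∑ i, castVec w i * castVec (v : Fin d → ℤ) i = -1 := fun v =>
          le_antisymm (hall v) (hval v)
        have := hlin μ
        simp only [heq, hμ.1, ← Finset.sum_mul, hμ.2] at this
        simp at this
      have hlt : -(m : ℝ) < ∑ i, castVec w i * castVec x i := by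
        rw [← hc.1, hlin, ← hc.2, ← Finset.sum_neg_distrib]
        refine Finset.sum_lt_sum (fun v _ => ?_) ⟨v₀, Finset.mem_univ _, ?_⟩
        · nlinarith [hval v, hc0 v]
        · nlinarith [hc0 v₀]
      have hcast : ∑ i, castVec w i * castVec x i = ((∑ i, w i * x i : ℤ) : ℝ) := by
        simp [castVec]
      rw [hcast] at hlt ⊢
      have : -m < ∑ i, w i * x i := by exact_mod_cast hlt
      exact_mod_cast (by omega : -(m - 1) ≤ ∑ i, w i * x i)
    have hsub : dualBody d (convexHull ℝ (castVec '' (V : Set (Fin d → ℤ)))) ⊆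
        {u | -((m - 1 : ℤ) : ℝ) ≤ ∑ i, u i * castVec x i} := by
      rw [hU]
      refine convexHull_min ?_ ?_
      · rintro _ ⟨w, hw, rfl⟩
        exact hge w hw
      · exact convex_halfSpace_ge ⟨fun a b => by simp [add_mul, Finset.sum_add_distrib],
          fun a b => by simp [mul_assoc, Finset.mul_sum]⟩ _
    have := hsub hu
    simp only [Set.mem_ofPred_eq] at this
    linarith
  · rintro ⟨hm, hx⟩
    obtain ⟨c, hc, hc0⟩ := (mem_smul_convexHull_castVec_iff hV _ _).1
      ⟨by exact_mod_cast hm, hx⟩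
    refine ⟨c + μ, ?_, fun v => add_pos_of_nonneg_of_pos (hc0 v) (hμ0 v)⟩
    rw [map_add, hc, hμ]
    simp

theorem finite_latticePts {d : ℕ} {S : Set (Fin d → ℝ)} (hS : Bornology.IsBounded S) :
    (latticePts d S).Finite := by
  obtain ⟨R, hR⟩ := hS.exists_norm_le
  refine (Set.finite_Icc (fun _ : Fin d => -⌈R⌉) (fun _ => ⌈R⌉)).subset fun x hx => ?_
  have h : ∀ i, |x i| ≤ ⌈R⌉ := fun i => by
    have h1 := (norm_le_pi_norm (fun i => (x i : ℝ)) i).trans (hR _ hx)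
    have h2 : ((|x i| : ℤ) : ℝ) ≤ (⌈R⌉ : ℝ) := by
      rw [Int.cast_abs]
      exact h1.trans (Int.le_ceil R)
    exact_mod_cast h2
  exact ⟨fun i => (abs_le.1 (h i)).1, fun i => (abs_le.1 (h i)).2⟩

end LatticePolytope

section EhrhartReciprocity

/-- The lattice points of `kP` for `k ≥ 0`, and the empty set for `k < 0`. -/
def dilatePts (d : ℕ) (P : Set (Fin d → ℝ)) (k : ℤ) : Set (Fin d → ℤ) :=
  {x | 0 ≤ k ∧ castVec x ∈ (k : ℝ) • P}

theorem dilatePts_natCast (d : ℕ) (P : Set (Fin d → ℝ)) (k : ℕ) :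
    dilatePts d P k = latticePts d ((k : ℝ) • P) := by
  ext x
  simp only [dilatePts, latticePts, Set.mem_ofPred_eq, Int.natCast_nonneg, true_and,
    Int.cast_natCast]
  rfl

theorem dilatePts_of_neg (d : ℕ) (P : Set (Fin d → ℝ)) {k : ℤ} (hk : k < 0) :
    dilatePts d P k = ∅ := by
  ext x
  simp [dilatePts, hk]

theorem finite_dilatePts {d : ℕ} {P : Set (Fin d → ℝ)} (hP : Bornology.IsBounded P) (k : ℤ) :
    (dilatePts d P k).Finite :=
  (finite_latticePts (hP.smul₀ (k : ℝ))).subset fun _ hx => hx.2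

theorem coneMap_indicator {d : ℕ} (V : Finset (Fin d → ℤ)) (I : Finset V) [DecidableEq V] :
    coneMap V (fun v => if v ∈ I then 1 else 0) =
      (castVec (∑ v ∈ I, (v : Fin d → ℤ)), ((I.card : ℤ) : ℝ)) := by
  rw [coneMap_apply]
  ext i
  · simp only [ite_smul, one_smul, zero_smul, Finset.sum_ite_mem, Finset.univ_inter]
    simp [castVec]
  · simp only [Finset.sum_ite_mem, Finset.univ_inter]
    simp

theorem castVec_sub {d : ℕ} (x y : Fin d → ℤ) : castVec (x - y) = castVec x - castVec y := by
  ext i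
  simp [castVec]

open scoped Classical in
theorem dilatePts_indicator_relation {d : ℕ} {V : Finset (Fin d → ℤ)} {P : Set (Fin d → ℝ)}
    (hP : P = convexHull ℝ (castVec '' (V : Set (Fin d → ℤ)))) (h0 : (0 : Fin d → ℝ) ∈ interior P)
    (hdual : IsLatticePolytope d (dualBody d P)) (x : Fin d → ℤ) (m : ℤ) :
    ∑ I : Finset V, (-1 : ℤ) ^ I.card *
      ((if x - ∑ v ∈ I, (v : Fin d → ℤ) ∈ dilatePts d P (m - I.card) then 1 else 0) +
        (-1) ^ d * (if ∑ v ∈ I, (v : Fin d → ℤ) - x ∈ dilatePts d P (-(m - I.card) - 1)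
          then 1 else 0)) = 0 := by
  subst hP
  have hV : V.Nonempty := by
    rw [Finset.nonempty_iff_ne_empty]
    rintro rfl
    simp at h0
  have h := cone_reciprocity (coneMap V) (coneMap_surjective h0) (LinearMap.snd ℝ _ _)
    (fun c => by simp [coneMap_apply]) (castVec x, (m : ℝ))
  have hA : ∀ I : Finset V, (∃ c, coneMap V c = (castVec x, (m : ℝ)) ∧
      ∀ i, (if i ∈ I then 1 else 0) ≤ c i) ↔
      x - ∑ v ∈ I, (v : Fin d → ℤ) ∈
        dilatePts d (convexHull ℝ (castVec '' (V : Set (Fin d → ℤ)))) (m - I.card) := by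
    intro I
    have hmem := mem_smul_convexHull_castVec_iff hV (castVec (x - ∑ v ∈ I, (v : Fin d → ℤ)))
      ((m - I.card : ℤ) : ℝ)
    rw [Int.cast_nonneg_iff] at hmem
    refine Iff.trans ?_ hmem.symm
    constructor
    · rintro ⟨c, hc, hc0⟩
      refine ⟨c - fun v => if v ∈ I then 1 else 0, ?_, fun v => sub_nonneg.2 (hc0 v)⟩
      rw [map_sub, hc, coneMap_indicator, castVec_sub]
      simp
    · rintro ⟨c, hc, hc0⟩
      refine ⟨c + fun v => if v ∈ I then 1 else 0, ?_, fun v => by simpa using hc0 v⟩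
      rw [map_add, hc, coneMap_indicator, castVec_sub]
      simp
  have hB : ∀ I : Finset V, (∃ c, coneMap V c = (castVec x, (m : ℝ)) ∧
      ∀ i, c i < (if i ∈ I then 1 else 0)) ↔
      ∑ v ∈ I, (v : Fin d → ℤ) - x ∈
        dilatePts d (convexHull ℝ (castVec '' (V : Set (Fin d → ℤ)))) (-(m - I.card) - 1) := by
    intro I
    have hmem := exists_pos_coneMap_iff hV h0 hdual (∑ v ∈ I, (v : Fin d → ℤ) - x) (-(m - I.card))
    refine Iff.trans ?_ hmem
    constructor
    · rintro ⟨c, hc, hc0⟩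
      refine ⟨(fun v => if v ∈ I then 1 else 0) - c, ?_, fun v => sub_pos.2 (hc0 v)⟩
      rw [map_sub, hc, coneMap_indicator, castVec_sub]
      simp
    · rintro ⟨c, hc, hc0⟩
      refine ⟨(fun v => if v ∈ I then 1 else 0) - c, ?_, fun v => by simpa using hc0 v⟩
      rw [map_sub, hc, coneMap_indicator, castVec_sub]
      simp
  have hrank : Module.finrank ℝ ((Fin d → ℝ) × ℝ) = d + 1 := by simp
  simp only [hA, hB, hrank] at h
  simp only [mul_add, Finset.sum_add_distrib]
  refine Eq.trans ?_ h
  rw [sub_eq_add_neg, Finset.mul_sum, ← Finset.sum_neg_distrib]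
  congr 1
  refine Finset.sum_congr rfl fun I _ => ?_
  rw [pow_succ]
  ring

open scoped Classical in
theorem sum_indicator_equiv {α : Type*} {S : Set α} {F : Finset α} (e : α ≃ α)
    (hF : e ⁻¹' S ⊆ F) : ∑ x ∈ F, (if e x ∈ S then 1 else 0 : ℤ) = S.ncard := by
  rw [← Finset.sum_filter, Finset.sum_const, nsmul_eq_mul, mul_one, Nat.cast_inj,
    ← Set.ncard_coe_finset]
  have : ((F.filter fun x => e x ∈ S : Finset α) : Set α) = e ⁻¹' S := by
    ext x
    simpa using fun hx => hF hx
  rw [this, Set.ncard_preimage_of_injective_subset_range e.injective (by simp)]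

theorem ncard_dilatePts_recurrence {d : ℕ} {V : Finset (Fin d → ℤ)} {P : Set (Fin d → ℝ)}
    (hP : P = convexHull ℝ (castVec '' (V : Set (Fin d → ℤ)))) (h0 : (0 : Fin d → ℝ) ∈ interior P)
    (hdual : IsLatticePolytope d (dualBody d P)) (m : ℤ) :
    ∑ I : Finset V, (-1 : ℤ) ^ I.card *
      (((dilatePts d P (m - I.card)).ncard : ℤ) +
        (-1) ^ d * ((dilatePts d P (-(m - I.card) - 1)).ncard : ℤ)) = 0 := by
  classical
  have hb : Bornology.IsBounded P := by
    rw [hP]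
    exact ((V.finite_toSet.image castVec).isCompact_convexHull ℝ).isBounded
  let s : Finset V → Fin d → ℤ := fun I => ∑ v ∈ I, (v : Fin d → ℤ)
  have hfin : (⋃ I : Finset V, (Equiv.subRight (s I) ⁻¹' dilatePts d P (m - I.card) ∪
      Equiv.subLeft (s I) ⁻¹' dilatePts d P (-(m - I.card) - 1))).Finite :=
    Set.finite_iUnion fun I =>
      ((finite_dilatePts hb _).preimage (Equiv.injective _).injOn).union
        ((finite_dilatePts hb _).preimage (Equiv.injective _).injOn)
  have hsum := Finset.sum_eq_zero fun x (_ : x ∈ hfin.toFinset) =>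
    dilatePts_indicator_relation hP h0 hdual x m
  rw [Finset.sum_comm] at hsum
  refine Eq.trans (Finset.sum_congr rfl fun I _ => ?_) hsum
  rw [← Finset.mul_sum, Finset.sum_add_distrib, ← Finset.mul_sum]
  rw [← sum_indicator_equiv (F := hfin.toFinset) (Equiv.subRight (s I)),
    ← sum_indicator_equiv (F := hfin.toFinset) (Equiv.subLeft (s I))]
  · simp [s]
  · rw [hfin.coe_toFinset]
    exact Set.subset_iUnion_of_subset I Set.subset_union_right
  · rw [hfin.coe_toFinset]
    exact Set.subset_iUnion_of_subset I Set.subset_union_left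

theorem eval_eq_of_alternating_recurrence {ι : Type*} [Fintype ι] (L : ℚ[X]) (h : ℤ → ℚ)
    (hL : ∀ k : ℕ, L.eval (k : ℚ) = h k)
    (hrec : ∀ m : ℤ, ∑ I : Finset ι, (-1 : ℚ) ^ I.card * h (m - I.card) = 0) (k : ℤ) :
    h k = L.eval (k : ℚ) := by
  set n := Fintype.card ι
  have hle : ∀ I : Finset ι, I.card ≤ n := fun I => Finset.card_le_univ I
  set Q : ℚ[X] := ∑ I : Finset ι, C ((-1 : ℚ) ^ I.card) * L.comp (X - C (I.card : ℚ))
  have hQ : ∀ m : ℕ, Q.eval ((m + n : ℕ) : ℚ) = 0 := by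
    intro m
    rw [← hrec (m + n : ℕ)]
    simp only [Q, eval_finsetSum, eval_mul, eval_C, eval_comp, eval_sub, eval_X]
    refine Finset.sum_congr rfl fun I _ => ?_
    have hc : ((m + n : ℕ) : ℤ) - I.card = ((m + n - I.card : ℕ) : ℤ) := by
      have := hle I
      omega
    rw [hc, ← hL, Nat.cast_sub ((hle I).trans (Nat.le_add_left n m))]
  have hQ0 : Q = 0 := by
    refine eq_zero_of_infinite_isRoot Q
      ((Set.infinite_range_of_injective (f := fun m : ℕ => ((m + n : ℕ) : ℚ)) ?_).mono ?_)
    · intro a b hab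
      simpa using hab
    · rintro _ ⟨m, rfl⟩
      exact hQ m
  have hLrec : ∀ m : ℤ, ∑ I : Finset ι, (-1 : ℚ) ^ I.card * L.eval ((m - I.card : ℤ) : ℚ) = 0 := by
    intro m
    have := congrArg (eval (m : ℚ)) hQ0
    simpa [Q, eval_finsetSum] using this
  have main : ∀ N : ℕ, ∀ k : ℤ, -(N : ℤ) ≤ k → h k - L.eval (k : ℚ) = 0 := by
    intro N
    induction N with
    | zero =>
      intro k hk
      lift k to ℕ using by simpa using hk
      simp [hL]
    | succ N ih =>
      intro k hk
      rcases lt_or_ge k (-(N : ℤ)) with hlt | hge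
      · have hdiff : ∑ I : Finset ι, (-1 : ℚ) ^ I.card *
            (h (k + n - I.card) - L.eval ((k + n - I.card : ℤ) : ℚ)) = 0 := by
          simp only [mul_sub, Finset.sum_sub_distrib, hrec, hLrec, sub_self]
        rw [Finset.sum_eq_single Finset.univ] at hdiff
        · simpa [n] using hdiff
        · intro I _ hI
          have hcard : I.card < n := (Finset.card_lt_iff_ne_univ I).2 hI
          rw [ih _ (by push_cast at hk; omega), mul_zero]
        · simp
      · exact ih k hge
  exact sub_eq_zero.1 (main k.natAbs k (by omega))

theorem ehrhart_comp_eq {d : ℕ} {P : Set (Fin d → ℝ)} {L : ℚ[X]} (hP : IsLatticePolytope d P)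
    (href : IsReflexive d P) (hL : IsEhrhart d P L) :
    L.comp (-X - 1) = (-1) ^ d * L := by
  obtain ⟨V, hV⟩ := hP
  have hrec := ncard_dilatePts_recurrence hV href.1 href.2
  have hL' : ∀ k : ℕ, L.eval (k : ℚ) = ((dilatePts d P k).ncard : ℚ) := fun k => by
    rw [hL, dilatePts_natCast]
  have key := eval_eq_of_alternating_recurrence (ι := V) L
    (fun k => ((dilatePts d P k).ncard : ℚ) + (-1) ^ d * ((dilatePts d P (-k - 1)).ncard : ℚ))
    (fun k => by
      rw [dilatePts_of_neg d P (by omega : -(k : ℤ) - 1 < 0), hL']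
      simp)
    (fun m => by exact_mod_cast hrec m)
  refine eq_of_infinite_eval_eq _ _
    ((Set.infinite_range_of_injective (Nat.cast_injective (R := ℚ))).mono ?_)
  rintro _ ⟨k, rfl⟩
  have h := key (-(k : ℤ) - 1)
  rw [dilatePts_of_neg d P (by omega : -(k : ℤ) - 1 < 0)] at h
  simp only [Set.ncard_empty, Nat.cast_zero, zero_add, neg_sub, sub_neg_eq_add,
    add_sub_cancel_left] at h
  rw [← hL'] at h
  simpa using h.symm

end EhrhartReciprocity

section LeadingCoefficient

open Filter Topology

theorem tendsto_latticePts_div_pow {d : ℕ} {P : Set (Fin d → ℝ)} (hP : IsCompact P)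
    (hc : Convex ℝ P) :
    Tendsto (fun m : ℕ => ((latticePts d ((m : ℝ) • P)).ncard : ℝ) / (m : ℝ) ^ d) atTop
      (𝓝 (vol d P)) := by
  have h := tendsto_card_div_pow_atTop_volume P hP.isBounded hP.measurableSet
    (hc.addHaar_frontier volume)
  rw [Fintype.card_fin] at h
  refine h.congr' ?_
  filter_upwards [eventually_gt_atTop 0] with m hm
  have hm' : (m : ℝ) ≠ 0 := by exact_mod_cast hm.ne'
  have himg : P ∩ (m : ℝ)⁻¹ • (Submodule.span ℤ (Set.range (Pi.basisFun ℝ (Fin d))) :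
      Set (Fin d → ℝ)) = (fun x : Fin d → ℤ => (m : ℝ)⁻¹ • castVec x) ''
        latticePts d ((m : ℝ) • P) := by
    ext y
    constructor
    · rintro ⟨hyP, z, hz, rfl⟩
      rw [SetLike.mem_coe, Module.Basis.mem_span_iff_repr_mem] at hz
      choose x hx using hz
      have hxz : castVec x = z := by
        ext i
        simpa [castVec] using hx i
      refine ⟨x, ?_, by simp [hxz]⟩
      change castVec x ∈ (m : ℝ) • P
      rw [hxz, Set.mem_smul_set_iff_inv_smul_mem₀ hm']
      exact hyP
    · rintro ⟨x, hx, rfl⟩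
      change castVec x ∈ (m : ℝ) • P at hx
      refine ⟨(Set.mem_smul_set_iff_inv_smul_mem₀ hm' _ _).1 hx, Set.smul_mem_smul_set ?_⟩
      rw [SetLike.mem_coe, Module.Basis.mem_span_iff_repr_mem]
      exact fun i => ⟨x i, by simp [castVec]⟩
  rw [himg, Nat.card_coe_set_eq, Set.ncard_image_of_injective]
  exact (smul_right_injective _ (inv_ne_zero hm')).comp castVec_injective

theorem degree_eq_and_leadingCoeff_eq_of_tendsto {L : ℝ[X]} {d : ℕ} {v : ℝ} (hv : 0 < v)
    (h : Tendsto (fun m : ℕ => L.eval (m : ℝ) / (m : ℝ) ^ d) atTop (𝓝 v)) :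
    L.degree = d ∧ L.leadingCoeff = v := by
  have hcast := tendsto_natCast_atTop_atTop (R := ℝ)
  have hX : ∀ x : ℝ, eval x (X ^ d : ℝ[X]) = x ^ d := by simp
  have hdeg : L.degree = (X ^ d : ℝ[X]).degree := by
    rcases lt_trichotomy L.degree (X ^ d : ℝ[X]).degree with hlt | heq | hgt
    · have := (div_tendsto_atTop_zero_of_degree_lt L _ hlt).comp hcast
      simp only [Function.comp_def, hX] at this
      exact absurd (tendsto_nhds_unique h this) hv.ne'
    · exact heq
    · rcases le_total 0 (L.leadingCoeff / (X ^ d : ℝ[X]).leadingCoeff) with hs | hs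
      · have := (div_tendsto_atTop_of_degree_gt L _ hgt (pow_ne_zero _ X_ne_zero) hs).comp hcast
        simp only [Function.comp_def, hX] at this
        exact absurd h (not_tendsto_nhds_of_tendsto_atTop this _)
      · have := (div_tendsto_atBot_of_degree_gt L _ hgt (pow_ne_zero _ X_ne_zero) hs).comp hcast
        simp only [Function.comp_def, hX] at this
        exact absurd h (not_tendsto_nhds_of_tendsto_atBot this _)
  have := (div_tendsto_atTop_leadingCoeff_div_of_degree_eq L _ hdeg).comp hcast
  simp only [Function.comp_def, hX, leadingCoeff_X_pow, div_one] at this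
  exact ⟨by rw [hdeg, degree_X_pow], (tendsto_nhds_unique h this).symm⟩

end LeadingCoefficient

section CriticalLine

theorem aeval_eq_of_comp_neg_eq_neg {M : ℝ[X]} (hdeg : M.natDegree = 5) (hodd : M.comp (-X) = -M)
    {A : Type*} [CommRing A] [Algebra ℝ A] (t : A) :
    aeval t M = algebraMap ℝ A (M.coeff 5) * t ^ 5 + algebraMap ℝ A (M.coeff 3) * t ^ 3
      + algebraMap ℝ A (M.coeff 1) * t := by
  have hc : ∀ n, Even n → M.coeff n = 0 := fun n hn => by
    have h := congrArg (fun p => coeff p n) hodd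
    simp only [show (-X : ℝ[X]) = C (-1) * X by simp, comp_C_mul_X_coeff, coeff_neg,
      hn.neg_one_pow, mul_one] at h
    linarith
  rw [aeval_eq_sum_range, hdeg]
  simp only [Finset.sum_range_succ, Finset.sum_range_zero, Algebra.smul_def]
  rw [hc 0 (by decide), hc 2 (by decide), hc 4 (by decide)]
  simp
  ring

theorem re_eq_zero_of_sq_eq_nonpos {t : ℂ} {w : ℝ} (h : t ^ 2 = w) (hw : w ≤ 0) : t.re = 0 := by
  have h1 := congrArg Complex.re h
  have h2 := congrArg Complex.im h
  simp only [sq, Complex.mul_re, Complex.mul_im, Complex.ofReal_re, Complex.ofReal_im] at h1 h2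
  have h3 : t.re * t.im = 0 := by linarith
  rcases mul_eq_zero.1 h3 with h | h
  · exact h
  · rw [h] at h1
    nlinarith

theorem sq_eq_of_re_eq_zero {t : ℂ} (h : t.re = 0) : t ^ 2 = ((-t.im ^ 2 : ℝ) : ℂ) := by
  apply Complex.ext <;> simp [sq, h]

theorem biquadratic_roots_imaginary_iff {v b c : ℝ} (hv : 0 < v) :
    (∀ t : ℂ, v * t ^ 4 + b * t ^ 2 + c = 0 → t.re = 0) ↔
      0 ≤ b ∧ 0 ≤ c ∧ 4 * v * c ≤ b ^ 2 := by
  have hvC : (v : ℂ) ≠ 0 := by exact_mod_cast hv.ne'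
  constructor
  · intro h
    have hroot : ∀ s : ℂ, s ^ 2 = ((b ^ 2 - 4 * v * c : ℝ) : ℂ) →
        ∃ y : ℝ, 0 ≤ y ∧ s = ((b - 2 * v * y : ℝ) : ℂ) := by
      intro s hs
      obtain ⟨t, ht⟩ := IsAlgClosed.exists_pow_nat_eq ((-b + s) / (2 * v)) (n := 2) (by norm_num)
      have ht' : 2 * v * t ^ 2 + b = s := by
        rw [ht]
        field_simp
        ring
      have hzero : v * t ^ 4 + b * t ^ 2 + c = 0 := by
        have : (4 * v : ℂ) * (v * t ^ 4 + b * t ^ 2 + c) = 0 := by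
          push_cast at hs
          rw [← ht'] at hs
          linear_combination hs
        exact (mul_eq_zero.1 this).resolve_left (by simpa using hvC)
      refine ⟨t.im ^ 2, sq_nonneg _, ?_⟩
      rw [← ht', sq_eq_of_re_eq_zero (h t hzero)]
      push_cast
      ring
    obtain ⟨s, hs⟩ := IsAlgClosed.exists_pow_nat_eq ((b ^ 2 - 4 * v * c : ℝ) : ℂ) (n := 2)
      (by norm_num)
    obtain ⟨y, hy, hsy⟩ := hroot s hs
    obtain ⟨z, hz, hsz⟩ := hroot (-s) (by rw [neg_sq, hs])
    rw [hsy] at hs hsz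
    have h1 : (b - 2 * v * y) ^ 2 = b ^ 2 - 4 * v * c := by exact_mod_cast hs
    have h2 : -(b - 2 * v * y) = b - 2 * v * z := by exact_mod_cast hsz
    have hb : b = v * (y + z) := by linarith
    have hcc : c = v * (y * z) := by
      have : (4 * v) * (c - v * (y * z)) = 0 := by rw [hb] at h1; linear_combination h1
      have := (mul_eq_zero.1 this).resolve_left (by positivity)
      linarith
    refine ⟨by rw [hb]; positivity, by rw [hcc]; positivity, ?_⟩
    nlinarith [sq_nonneg (b - 2 * v * y)]
  · rintro ⟨hb, hc, hD⟩ t ht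
    have hD' : 0 ≤ b ^ 2 - 4 * v * c := by linarith
    set r := √(b ^ 2 - 4 * v * c)
    have hr : r ^ 2 = b ^ 2 - 4 * v * c := Real.sq_sqrt hD'
    have hr0 : 0 ≤ r := Real.sqrt_nonneg _
    have hrb : r ≤ b := abs_le_of_sq_le_sq' (by nlinarith) hb |>.2
    have hrC : (r : ℂ) ^ 2 = b ^ 2 - 4 * v * c := by exact_mod_cast congrArg Complex.ofReal hr
    have hprod : (2 * v * t ^ 2 + b - r) * (2 * v * t ^ 2 + b + r) = 0 := by
      linear_combination 4 * v * ht - hrC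
    rcases mul_eq_zero.1 hprod with h | h
    · refine re_eq_zero_of_sq_eq_nonpos (w := (r - b) / (2 * v)) ?_
        (div_nonpos_of_nonpos_of_nonneg (by linarith) (by linarith))
      push_cast
      rw [eq_div_iff (by simpa using hvC)]
      linear_combination h
    · refine re_eq_zero_of_sq_eq_nonpos (w := (-r - b) / (2 * v)) ?_
        (div_nonpos_of_nonpos_of_nonneg (by linarith) (by linarith))
      push_cast
      rw [eq_div_iff (by simpa using hvC)]
      linear_combination h

end CriticalLine

theorem statement12 (P : Set (Fin 5 → ℝ)) (L : Polynomial ℚ)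
    (hP : IsLatticePolytope 5 P) (hdim : IsFullDim 5 P) (href : IsReflexive 5 P)
    (hL : IsEhrhart 5 P L) :
    IsCL L ↔
      (vol 5 P = 32 ∧ (latticePts 5 P).ncard = 243) ∨
      (15 * vol 5 P < 2 * (((latticePts 5 P).ncard : ℝ) - 3) ∧
        4 * ((latticePts 5 P).ncard : ℝ) ≤ 27 * (vol 5 P + 4) ∧
        (((latticePts 5 P).ncard : ℝ) - 3 - 6 * vol 5 P) ^ 2 ≥ 72 * vol 5 P) := by
  have hcompact : IsCompact P := by
    obtain ⟨V, rfl⟩ := hP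
    exact (V.finite_toSet.image _).isCompact_convexHull ℝ
  have hconvex : Convex ℝ P := by
    obtain ⟨V, rfl⟩ := hP
    exact convex_convexHull ℝ _
  have hvol : 0 < vol 5 P :=
    ENNReal.toReal_pos (Measure.measure_pos_of_mem_nhds volume
      (mem_interior_iff_mem_nhds.1 href.1)).ne' hcompact.measure_lt_top.ne
  set v := vol 5 P
  set n := (latticePts 5 P).ncard
  set R : ℝ[X] := L.map (algebraMap ℚ ℝ)
  have hReval : ∀ m : ℕ, R.eval (m : ℝ) = ((latticePts 5 ((m : ℝ) • P)).ncard : ℝ) := fun m => by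
    have h := congrArg (algebraMap ℚ ℝ) (hL m)
    rw [← eval_map_apply, map_natCast, map_natCast] at h
    exact h
  obtain ⟨hdeg, hlead⟩ := degree_eq_and_leadingCoeff_eq_of_tendsto hvol
    ((tendsto_latticePts_div_pow hcompact hconvex).congr fun m => by rw [hReval])
  have hnat : R.natDegree = 5 := natDegree_eq_of_degree_eq_some hdeg
  have hsymm : R.comp (-X - 1) = -R := by
    have h := congrArg (Polynomial.map (algebraMap ℚ ℝ)) (ehrhart_comp_eq hP href hL)
    simpa [R, map_comp, Odd.neg_one_pow (by decide : Odd 5)] using h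
  set M : ℝ[X] := R.comp (X - C (1 / 2))
  have hMnat : M.natDegree = 5 := by simp [M, natDegree_comp, hnat]
  have hMlead : M.coeff 5 = v := by
    rw [← hMnat, coeff_natDegree, leadingCoeff_comp (by simp), hlead]
    simp
  have hodd : M.comp (-X) = -M := by
    have h := congrArg (fun p => p.comp (X - C (1 / 2))) hsymm
    simp only [neg_comp] at h
    rw [← h, comp_assoc, comp_assoc]
    congr 1
    simp only [sub_comp, neg_comp, X_comp, C_comp, one_comp]
    rw [← C_1, neg_sub', sub_neg_eq_add, sub_eq_add_neg, ← C_neg, add_sub_assoc, ← C_sub]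
    norm_num
  have hform := fun t : ℝ => aeval_eq_of_comp_neg_eq_neg hMnat hodd t
  set b := M.coeff 3
  set c := M.coeff 1
  have h0 := hform (1 / 2)
  have h1 := hform (3 / 2)
  have hL0 : R.eval 0 = 1 := by
    have h := hReval 0
    rw [Nat.cast_zero, Set.zero_smul_set ⟨0, interior_subset href.1⟩] at h
    rw [h]
    have : latticePts 5 (0 : Set (Fin 5 → ℝ)) = {0} := by
      ext x
      simp [latticePts, funext_iff]
    simp [this]
  have hL1 : R.eval 1 = n := by simpa using hReval 1
  simp only [M, hMlead, coe_aeval_eq_eval, eval_comp, eval_sub, eval_X, eval_C,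
    Algebra.algebraMap_self, RingHom.id_apply] at h0 h1
  norm_num [hL0, hL1] at h0 h1
  have hb : b = (n - 3) / 3 - 5 * v / 2 := by linarith
  have hc : c = 9 / 4 - n / 12 + 9 * v / 16 := by linarith
  have hCL : IsCL L ↔ ∀ t : ℂ, v * t ^ 4 + b * t ^ 2 + c = 0 → t.re = 0 := by
    have hne : L.map (algebraMap ℚ ℂ) ≠ 0 := by
      refine (Polynomial.map_ne_zero_iff (algebraMap ℚ ℂ).injective).2 fun h => ?_
      simp [R, h] at hnat
    have hroot : ∀ z : ℂ, z ∈ cRoots L ↔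
        (z + 1 / 2) * (v * (z + 1 / 2) ^ 4 + b * (z + 1 / 2) ^ 2 + c) = 0 := by
      intro z
      have h := aeval_eq_of_comp_neg_eq_neg hMnat hodd (z + 1 / 2)
      have hz : aeval (z + 1 / 2) M = (L.map (algebraMap ℚ ℂ)).eval z := by
        simp [M, R, aeval_comp, eval_map_algebraMap]
      rw [cRoots, mem_roots hne, IsRoot.def, ← hz, h, hMlead]
      simp only [Complex.coe_algebraMap]
      constructor <;> intro h <;> linear_combination h
    constructor
    · intro h t ht
      have := h (t - 1 / 2) ((hroot _).2 (by simp [ht]))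
      norm_num at this
      linarith
    · intro h z hz
      rcases mul_eq_zero.1 ((hroot z).1 hz) with hz | hz
      · rw [eq_neg_of_add_eq_zero_left hz]
        norm_num
      · have := h _ hz
        norm_num at this
        linarith
  rw [hCL, biquadratic_roots_imaginary_iff hvol]
  have hdisc : 9 * (b ^ 2 - 4 * v * c) = ((n : ℝ) - 3 - 6 * v) ^ 2 - 72 * v := by
    rw [hb, hc]
    ring
  constructor
  · rintro ⟨hb0, hc0, hD⟩
    rcases hb0.eq_or_lt with hb' | hb'
    · left
      have hc' : c = 0 := by
        rw [← hb'] at hD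
        nlinarith
      have hv : v = 32 := by linarith
      refine ⟨hv, ?_⟩
      have : (n : ℝ) = 243 := by linarith
      exact_mod_cast this
    · right
      exact ⟨by linarith, by linarith, by linarith⟩
  · rintro (⟨hv, hn⟩ | ⟨h1, h2, h3⟩)
    · have hn' : (n : ℝ) = 243 := by exact_mod_cast hn
      rw [hv, hn'] at hb hc
      norm_num at hb hc
      simp [hb, hc]
    · exact ⟨by linarith, by linarith, by linarith⟩
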